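/- arXiv:2106.02517 — 2 statements merged into one kernel-verified Lean document; each statement's English description precedes it below -/
import Mathlib

section
/- Let d be an odd positive integer and let x ∈ ℂ^d be indexed by [d]_c with indices interpreted cyclically modulo d. Let x̂ := F_d x. Then for all integers ℓ and ω: (F_d(x ∘ S_ω x̄))_ℓ = d·e^{2πiωℓ/d}·(F_d(x̂ ∘ S_{−ℓ} conj(x̂)))_ω, where indices of entries are taken modulo d. -/
open Real

/-- `[n]_c`, the set of `n` consecutive integers centered at the origin (for odd `n`):
`{(1−n)/2, …, (n−1)/2} = {−(n/2), …, n/2}` (integer division). -/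
noncomputable def Icen (n : ℤ) : Finset ℤ := Finset.Icc (-(n / 2)) (n / 2)

/-- The discrete Fourier transform associated with the matrix `F_d`,
`(F_d v)_j = (1/d) ∑_{p∈[d]_c} e^{−2πijp/d} v_p`, acting on `d`-periodic sequences. -/
noncomputable def dft (d : ℤ) (v : ℤ → ℂ) (j : ℤ) : ℂ :=
  (1 / (d : ℂ)) * ∑ p ∈ Icen d,
    Complex.exp (-2 * (π : ℂ) * Complex.I * (j : ℂ) * (p : ℂ) / (d : ℂ)) * v p

theorem sum_Icen_add_one {d : ℤ} (hd : Odd d) (hdpos : 0 < d) {f : ℤ → ℂ}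
    (hf : Function.Periodic f d) : ∑ p ∈ Icen d, f (p + 1) = ∑ p ∈ Icen d, f p := by
  obtain ⟨m, rfl⟩ := hd
  have hm : (2 * m + 1) / 2 = m := by omega
  have hshift : ∑ p ∈ Finset.Icc (-m) m, f (p + 1) = ∑ p ∈ Finset.Icc (-m + 1) (m + 1), f p := by
    rw [← Finset.map_add_right_Icc, Finset.sum_map]
    rfl
  have hleft : insert (-m) (Finset.Icc (-m + 1) (m + 1)) = Finset.Icc (-m) (m + 1) := by
    ext; simp only [Finset.mem_insert, Finset.mem_Icc]; omega
  have hright : insert (m + 1) (Finset.Icc (-m) m) = Finset.Icc (-m) (m + 1) := by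
    ext; simp only [Finset.mem_insert, Finset.mem_Icc]; omega
  have hends : f (m + 1) = f (-m) := by
    rw [← hf (-m)]; congr 1; ring
  have h := congrArg (fun s => ∑ p ∈ s, f p) (hleft.trans hright.symm)
  rw [Finset.sum_insert (by simp), Finset.sum_insert (by simp), hends] at h
  rw [Icen, hm, hshift]
  exact add_left_cancel h

theorem sum_Icen_add {d : ℤ} (hd : Odd d) (hdpos : 0 < d) {f : ℤ → ℂ}
    (hf : Function.Periodic f d) (k : ℤ) :
    ∑ p ∈ Icen d, f (p + k) = ∑ p ∈ Icen d, f p := by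
  have hstep (k : ℤ) : ∑ p ∈ Icen d, f (p + (k + 1)) = ∑ p ∈ Icen d, f (p + k) := by
    rw [← sum_Icen_add_one hd hdpos (f := fun p => f (p + k)) fun p => by
      simpa only [add_right_comm] using hf (p + k)]
    exact Finset.sum_congr rfl fun p _ => by ring_nf
  induction k using Int.induction_on with
  | zero => simp
  | succ k ih => rw [hstep, ih]
  | pred k ih => rw [← ih, ← hstep, sub_add_cancel]

theorem card_Icen {d : ℤ} (hd : Odd d) (hdpos : 0 < d) : ((Icen d).card : ℂ) = d := by
  obtain ⟨m, rfl⟩ := hd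
  have h : ((Icen (2 * m + 1)).card : ℤ) = 2 * m + 1 := by
    rw [Icen, Int.card_Icc]; omega
  exact_mod_cast h

theorem eq_zero_of_mem_Icen_of_dvd {d : ℤ} (hd : Odd d) {q : ℤ} (hq : q ∈ Icen d)
    (hdvd : d ∣ q) : q = 0 := by
  rw [Icen, Finset.mem_Icc] at hq
  obtain ⟨m, rfl⟩ := hd
  exact Int.eq_zero_of_abs_lt_dvd hdvd (by rw [abs_lt]; omega)

/-- The additive character `n ↦ e^{2πin/d}` of `ℤ`. -/
noncomputable def rootChar (d n : ℤ) : ℂ :=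
  Complex.exp (2 * (π : ℂ) * Complex.I * (n : ℂ) / (d : ℂ))

theorem rootChar_add (d m n : ℤ) : rootChar d (m + n) = rootChar d m * rootChar d n := by
  rw [rootChar, rootChar, rootChar, ← Complex.exp_add]
  push_cast
  ring_nf

theorem conj_rootChar (d n : ℤ) : (starRingEnd ℂ) (rootChar d n) = rootChar d (-n) := by
  rw [rootChar, rootChar, ← Complex.exp_conj]
  simp [map_ofNat]

theorem rootChar_eq_one_iff {d : ℤ} (hd : d ≠ 0) (n : ℤ) : rootChar d n = 1 ↔ d ∣ n := by
  have hd' : (d : ℂ) ≠ 0 := by exact_mod_cast hd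
  rw [rootChar, Complex.exp_eq_one_iff]
  refine exists_congr fun k => ?_
  rw [div_eq_iff hd', ← Int.cast_inj (α := ℂ)]
  push_cast
  constructor <;> intro h
  · apply mul_left_cancel₀ Complex.two_pi_I_ne_zero
    linear_combination h
  · rw [h]; ring

theorem rootChar_mul_periodic {d : ℤ} (hd : d ≠ 0) (k : ℤ) :
    Function.Periodic (fun n => rootChar d (k * n)) d := fun n => by
  have h : rootChar d (k * d) = 1 := (rootChar_eq_one_iff hd _).2 (dvd_mul_left d k)
  simp only [mul_add, rootChar_add, h, mul_one]

theorem sum_rootChar {d : ℤ} (hd : Odd d) (hdpos : 0 < d) (m : ℤ) :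
    ∑ j ∈ Icen d, rootChar d (m * j) = if d ∣ m then (d : ℂ) else 0 := by
  split_ifs with h
  · rw [Finset.sum_congr rfl fun j _ =>
      (rootChar_eq_one_iff hdpos.ne' (m * j)).2 (h.mul_right j)]
    simp [card_Icen hd hdpos]
  · have hs := sum_Icen_add_one hd hdpos (rootChar_mul_periodic hdpos.ne' m)
    simp only [mul_add, mul_one, rootChar_add, ← Finset.sum_mul] at hs
    have hne : rootChar d m - 1 ≠ 0 :=
      sub_ne_zero.2 (mt (rootChar_eq_one_iff hdpos.ne' m).1 h)
    refine (mul_eq_zero.1 ?_).resolve_right hne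
    rw [mul_sub, hs, mul_one, sub_self]

theorem dft_eq_sum_rootChar (d : ℤ) (v : ℤ → ℂ) (j : ℤ) :
    dft d v j = (1 / (d : ℂ)) * ∑ p ∈ Icen d, rootChar d (-(j * p)) * v p := by
  rw [dft]
  congr 1
  refine Finset.sum_congr rfl fun p _ => ?_
  rw [rootChar]
  push_cast
  ring_nf

theorem sum_sum_rootChar_mul {d : ℤ} (hd : Odd d) (hdpos : 0 < d) {g : ℤ → ℂ}
    (hg : Function.Periodic g d) (k : ℤ) :
    ∑ q ∈ Icen d, g q * ∑ j ∈ Icen d, rootChar d ((q - k) * j) = d * g k := by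
  have hper : Function.Periodic
      (fun q => g q * ∑ j ∈ Icen d, rootChar d ((q - k) * j)) d := fun q => by
    simp only [sum_rootChar hd hdpos, hg q, add_sub_right_comm, dvd_add_self_right]
  rw [← sum_Icen_add hd hdpos hper k, Finset.sum_eq_single 0]
  · rw [sum_rootChar hd hdpos, if_pos (by simp), zero_add, mul_comm]
  · intro q hq hq0
    have : ¬ d ∣ q := mt (eq_zero_of_mem_Icen_of_dvd hd hq) hq0
    simp [sum_rootChar hd hdpos, this]
  · intro h0
    exact absurd (by rw [Icen, Finset.mem_Icc]; omega) h0

/-- For a `d`-periodic vector `x` (indexed by `[d]_c` cyclically) with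
`x̂ = F_d x`, one has, for all integers `ℓ, ω`,
`(F_d(x ∘ S_ω conj x))_ℓ = d·e^{2πiωℓ/d}·(F_d(x̂ ∘ S_{−ℓ} conj x̂))_ω`. -/
theorem stmt6 (d : ℤ) (hd : Odd d) (hdpos : 0 < d)
    (x : ℤ → ℂ) (hper : ∀ p : ℤ, x (p + d) = x p)
    (xh : ℤ → ℂ) (hxh : ∀ j : ℤ, xh j = dft d x j) (ℓ ω : ℤ) :
    dft d (fun p => x p * (starRingEnd ℂ) (x (p + ω))) ℓ
      = (d : ℂ) * Complex.exp (2 * (π : ℂ) * Complex.I * (ω : ℂ) * (ℓ : ℂ) / (d : ℂ)) *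
        dft d (fun j => xh j * (starRingEnd ℂ) (xh (j - ℓ))) ω := by
  have hd0 : (d : ℂ) ≠ 0 := by exact_mod_cast hdpos.ne'
  have hexp : Complex.exp (2 * (π : ℂ) * Complex.I * (ω : ℂ) * (ℓ : ℂ) / (d : ℂ))
      = rootChar d (ω * ℓ) := by
    rw [rootChar]; push_cast; ring_nf
  have hper' : Function.Periodic
      (fun q => rootChar d (-ℓ * q) * (starRingEnd ℂ) (x q)) d :=
    (rootChar_mul_periodic hdpos.ne' (-ℓ)).mul fun q => by simp only [hper]
  have hterm (j : ℤ) : rootChar d (-(ω * j)) * (xh j * (starRingEnd ℂ) (xh (j - ℓ)))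
      = (1 / (d : ℂ)) ^ 2 * ∑ p ∈ Icen d, ∑ q ∈ Icen d,
        x p * (rootChar d (-ℓ * q) * (starRingEnd ℂ) (x q) *
          rootChar d ((q - (p + ω)) * j)) := by
    have hchar (p q : ℤ) : rootChar d (-ℓ * q) * rootChar d ((q - (p + ω)) * j)
        = rootChar d (-(ω * j)) * rootChar d (-(j * p)) * rootChar d ((j - ℓ) * q) := by
      simp only [← rootChar_add]; ring_nf
    rw [hxh, hxh, dft_eq_sum_rootChar, dft_eq_sum_rootChar]
    simp only [map_mul, map_sum, map_div₀, map_one, map_intCast, conj_rootChar, neg_neg]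
    rw [mul_mul_mul_comm, Finset.sum_mul_sum, mul_left_comm, ← sq]
    congr 1
    simp only [Finset.mul_sum]
    refine Finset.sum_congr rfl fun p _ => Finset.sum_congr rfl fun q _ => ?_
    linear_combination (-x p * (starRingEnd ℂ) (x q)) * hchar p q
  have hsum : ∑ j ∈ Icen d, rootChar d (-(ω * j)) * (xh j * (starRingEnd ℂ) (xh (j - ℓ)))
      = (1 / (d : ℂ)) ^ 2 * ∑ p ∈ Icen d,
        x p * (d * (rootChar d (-ℓ * (p + ω)) * (starRingEnd ℂ) (x (p + ω)))) := by
    rw [Finset.sum_congr rfl fun j _ => hterm j, ← Finset.mul_sum, Finset.sum_comm]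
    congr 1
    refine Finset.sum_congr rfl fun p _ => ?_
    rw [Finset.sum_comm, ← sum_sum_rootChar_mul hd hdpos hper' (p + ω)]
    simp only [Finset.mul_sum]
  rw [hexp, dft_eq_sum_rootChar, dft_eq_sum_rootChar, hsum]
  simp only [Finset.mul_sum]
  refine Finset.sum_congr rfl fun p _ => ?_
  have hphase : rootChar d (-(ℓ * p)) = rootChar d (ω * ℓ) * rootChar d (-ℓ * (p + ω)) := by
    rw [← rootChar_add]; ring_nf
  rw [hphase]
  field_simp
end

section
/- Let d be an odd positive integer, let L divide d, let ρ be an even positive integer, and suppose L = ρ + κ for some integer κ with 2 ≤ κ ≤ ρ. Let w ∈ ℂ^d (indexed by [d]_c) satisfy w_q = 0 for all q ∈ [d]_c with |q| > ρ/2. Then for every integer ℓ with |ℓ| ≤ κ−1 and every q ∈ [d/L]_c with q ≠ 0, the vector w ∘ S_{ℓ−qL} conj(w) is identically zero (cyclic shift modulo d). -/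
open Real

/-- If a `d`-periodic `w` vanishes at the `q ∈ [d]_c` with `|q| > r`, then every point where `w`
is nonzero is congruent modulo `d` to some `a` with `|a| ≤ r`. -/
theorem exists_abs_le_of_periodic_ne_zero {d r : ℤ} (hd : Odd d) (hdpos : 0 < d) {w : ℤ → ℂ}
    (hper : Function.Periodic w d) (hsupp : ∀ q ∈ Icen d, r < |q| → w q = 0)
    {p : ℤ} (hp : w p ≠ 0) : ∃ a k : ℤ, p = a + k * d ∧ |a| ≤ r := by
  have hdiv := Int.emod_add_mul_ediv (p + d / 2) d
  have hnonneg := Int.emod_nonneg (p + d / 2) hdpos.ne'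
  have hlt := Int.emod_lt_of_pos (p + d / 2) hdpos
  set a := (p + d / 2) % d - d / 2 with ha
  set k := (p + d / 2) / d
  have hpa : p = a + k * d := by linarith
  refine ⟨a, k, hpa, not_lt.mp fun h => hp ?_⟩
  rw [hpa, ← Int.cast_id (n := k), hper.int_mul k a]
  refine hsupp a (Finset.mem_Icc.mpr ⟨by omega, ?_⟩) h
  obtain ⟨m, rfl⟩ := hd
  omega

/-- Let `d` be odd, `L ∣ d`, `L = ρ + κ` with `2 ≤ κ ≤ ρ`, `ρ` even and
positive.  If the `d`-periodic vector `w` vanishes at every `q ∈ [d]_c` with `|q| > ρ/2`,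
then for every `ℓ` with `|ℓ| ≤ κ−1` and every nonzero `q ∈ [d/L]_c`, the vector
`w ∘ S_{ℓ−qL} conj(w)` is identically zero. -/
theorem stmt9 (d L ρ κ : ℤ) (hd : Odd d) (hdpos : 0 < d) (hL : L ∣ d)
    (hρe : Even ρ) (hρpos : 0 < ρ) (hLρκ : L = ρ + κ) (hκ : 2 ≤ κ) (hκρ : κ ≤ ρ)
    (w : ℤ → ℂ) (hper : ∀ p : ℤ, w (p + d) = w p)
    (hsupp : ∀ q ∈ Icen d, ρ / 2 < |q| → w q = 0) :
    ∀ ℓ : ℤ, |ℓ| ≤ κ - 1 → ∀ q ∈ Icen (d / L), q ≠ 0 →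
      ∀ p : ℤ, w p * (starRingEnd ℂ) (w (p + (ℓ - q * L))) = 0 := by
  intro ℓ hℓ q hq hq0 p
  by_contra hne
  obtain ⟨hp, hp'⟩ := mul_ne_zero_iff.mp hne
  rw [map_ne_zero] at hp'
  obtain ⟨a, k, hpa, ha⟩ := exists_abs_le_of_periodic_ne_zero hd hdpos hper hsupp hp
  obtain ⟨b, m, hpb, hb⟩ := exists_abs_le_of_periodic_ne_zero hd hdpos hper hsupp hp'
  obtain ⟨n, rfl⟩ := hL
  have hLpos : 0 < L := by omega
  have hn : 0 < n := pos_of_mul_pos_right hdpos hLpos.le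
  rw [Int.mul_ediv_cancel_left n hLpos.ne', Icen, Finset.mem_Icc] at hq
  have hmul : L * (q + (m - k) * n) = ℓ + a - b := by linear_combination hpa - hpb
  rw [abs_le] at hℓ ha hb
  have hdiff : ℓ + a - b = 0 :=
    Int.eq_zero_of_abs_lt_dvd ⟨_, hmul.symm⟩ (abs_lt.mpr ⟨by omega, by omega⟩)
  have hzero : q + (m - k) * n = 0 :=
    (mul_eq_zero.mp (hmul.trans hdiff)).resolve_left hLpos.ne'
  exact hq0 (Int.eq_zero_of_abs_lt_dvd (m := n) ⟨k - m, by linear_combination hzero⟩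
    (abs_lt.mpr ⟨by omega, by omega⟩))
end
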